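/- Let (x,y,z) be a generic purely imaginary triple of octonions, i.e. x = x₂ i, y = y₂ i + y₃ j, z = z₂ i + z₃ j + z₄ k + z₈ ℓ with real coefficients and x₂ y₃ z₈ ≠ 0, and set v = (x,y,z)ᵀ and λ = [x,y,z] ≠ 0. If A = !![p, a, conj c; conj a, m, b; c, conj b, n] and A' = !![p', a', conj c'; conj a', m', b'; c', conj b', n'] are Jordan matrices both satisfying A v = v λ and A' v = v λ, with the same diagonal entries (p = p', m = m', n = n') and with the entries b, b' having the same components in the directions 1, k, and iℓ, then A = A'. Hence the Jordan matrices admitting v as eigenvector with eigenvalue [v] are uniquely parameterized by the six real parameters (p, m, n, b₁, b₄, b₇). -/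

import Mathlib

noncomputable section

/-- The octonions, as the Cayley–Dickson double of the quaternions. -/
def Octonion : Type := Quaternion ℝ × Quaternion ℝ

namespace Octonion

instance : AddCommGroup Octonion :=
  inferInstanceAs (AddCommGroup (Quaternion ℝ × Quaternion ℝ))

instance : Module ℝ Octonion :=
  inferInstanceAs (Module ℝ (Quaternion ℝ × Quaternion ℝ))

/-- Cayley–Dickson multiplication: (a,b)·(c,d) = (a c − conj(d) b, d a + b conj(c)). -/
instance : Mul Octonion :=
  ⟨fun x y => (x.1 * y.1 - star y.2 * x.2, y.2 * x.1 + x.2 * star y.1)⟩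

instance : One Octonion := ⟨((1 : Quaternion ℝ), 0)⟩

/-- Octonionic conjugation: conj (a,b) = (conj a, −b). -/
def conj (x : Octonion) : Octonion := (star x.1, -x.2)

/-- Real part of an octonion. -/
def re (x : Octonion) : ℝ := x.1.re

/-- Imaginary part of an octonion. -/
def im (x : Octonion) : Octonion := x - re x • 1

/-- Embedding of the reals into the octonions. -/
def ofReal (r : ℝ) : Octonion := (((r : ℝ) : Quaternion ℝ), 0)

/-- The squared norm |w|² (the real scalar such that w · conj w = |w|² · 1). -/
def normSq (x : Octonion) : ℝ := Quaternion.normSq x.1 + Quaternion.normSq x.2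

/-- The imaginary unit i. -/
def i : Octonion := ((⟨0, 1, 0, 0⟩ : Quaternion ℝ), 0)

/-- The imaginary unit j. -/
def j : Octonion := ((⟨0, 0, 1, 0⟩ : Quaternion ℝ), 0)

/-- The imaginary unit k. -/
def k : Octonion := ((⟨0, 0, 0, 1⟩ : Quaternion ℝ), 0)

/-- The imaginary unit ℓ. -/
def l : Octonion := ((0 : Quaternion ℝ), (1 : Quaternion ℝ))

/-- The associator [x,y,z] = (xy)z − x(yz). -/
def assoc (x y z : Octonion) : Octonion := x * y * z - x * (y * z)

/-- A Jordan matrix: a 3×3 Hermitian matrix over the octonions. -/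
def IsHermitian (A : Matrix (Fin 3) (Fin 3) Octonion) : Prop :=
  ∀ p q : Fin 3, conj (A q p) = A p q

/-- The right eigenvalue equation `A v = v λ`, componentwise. -/
def Eig (A : Matrix (Fin 3) (Fin 3) Octonion) (v : Fin 3 → Octonion) (lam : Octonion) : Prop :=
  ∀ p : Fin 3, A p 0 * v 0 + A p 1 * v 1 + A p 2 * v 2 = v p * lam

end Octonion

namespace Octonion

theorem ext_coords {x y : Octonion} (h₁ : x.1.re = y.1.re) (h₂ : x.1.imI = y.1.imI)
    (h₃ : x.1.imJ = y.1.imJ) (h₄ : x.1.imK = y.1.imK) (h₅ : x.2.re = y.2.re)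
    (h₆ : x.2.imI = y.2.imI) (h₇ : x.2.imJ = y.2.imJ) (h₈ : x.2.imK = y.2.imK) : x = y :=
  Prod.ext (QuaternionAlgebra.ext h₁ h₂ h₃ h₄) (QuaternionAlgebra.ext h₅ h₆ h₇ h₈)

theorem fst_add (x y : Octonion) : (x + y).1 = x.1 + y.1 := rfl
theorem snd_add (x y : Octonion) : (x + y).2 = x.2 + y.2 := rfl
theorem fst_sub (x y : Octonion) : (x - y).1 = x.1 - y.1 := rfl
theorem snd_sub (x y : Octonion) : (x - y).2 = x.2 - y.2 := rfl
theorem fst_neg (x : Octonion) : (-x).1 = -x.1 := rfl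
theorem snd_neg (x : Octonion) : (-x).2 = -x.2 := rfl
theorem fst_zero : (0 : Octonion).1 = 0 := rfl
theorem snd_zero : (0 : Octonion).2 = 0 := rfl
theorem fst_one : (1 : Octonion).1 = 1 := rfl
theorem snd_one : (1 : Octonion).2 = 0 := rfl
theorem fst_smul (r : ℝ) (x : Octonion) : (r • x).1 = r • x.1 := rfl
theorem snd_smul (r : ℝ) (x : Octonion) : (r • x).2 = r • x.2 := rfl
theorem fst_mul (x y : Octonion) : (x * y).1 = x.1 * y.1 - star y.2 * x.2 := rfl
theorem snd_mul (x y : Octonion) : (x * y).2 = y.2 * x.1 + x.2 * star y.1 := rfl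
theorem fst_conj (x : Octonion) : (conj x).1 = star x.1 := rfl
theorem snd_conj (x : Octonion) : (conj x).2 = -x.2 := rfl

theorem coords_i : i.1.re = 0 ∧ i.1.imI = 1 ∧ i.1.imJ = 0 ∧ i.1.imK = 0 ∧ i.2 = 0 :=
  ⟨rfl, rfl, rfl, rfl, rfl⟩

theorem coords_j : j.1.re = 0 ∧ j.1.imI = 0 ∧ j.1.imJ = 1 ∧ j.1.imK = 0 ∧ j.2 = 0 :=
  ⟨rfl, rfl, rfl, rfl, rfl⟩

theorem coords_k : k.1.re = 0 ∧ k.1.imI = 0 ∧ k.1.imJ = 0 ∧ k.1.imK = 1 ∧ k.2 = 0 :=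
  ⟨rfl, rfl, rfl, rfl, rfl⟩

theorem coords_l : l.1 = 0 ∧ l.2.re = 1 ∧ l.2.imI = 0 ∧ l.2.imJ = 0 ∧ l.2.imK = 0 :=
  ⟨rfl, rfl, rfl, rfl, rfl⟩

theorem coords_zero : (0 : Octonion).1.re = 0 ∧ (0 : Octonion).1.imI = 0 ∧
    (0 : Octonion).1.imJ = 0 ∧ (0 : Octonion).1.imK = 0 ∧ (0 : Octonion).2.re = 0 ∧
    (0 : Octonion).2.imI = 0 ∧ (0 : Octonion).2.imJ = 0 ∧ (0 : Octonion).2.imK = 0 :=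
  ⟨rfl, rfl, rfl, rfl, rfl, rfl, rfl, rfl⟩

protected theorem sub_mul (x y w : Octonion) : (x - y) * w = x * w - y * w := by
  refine Prod.ext ?_ ?_ <;>
    simp only [fst_sub, snd_sub, fst_mul, snd_mul] <;> noncomm_ring

protected theorem smul_mul (r : ℝ) (x y : Octonion) : (r • x) * y = r • (x * y) := by
  refine Prod.ext ?_ ?_ <;>
    simp only [fst_smul, snd_smul, fst_mul, snd_mul, smul_sub, smul_add, smul_mul_assoc,
      mul_smul_comm]

protected theorem mul_smul (r : ℝ) (x y : Octonion) : x * (r • y) = r • (x * y) := by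
  refine Prod.ext ?_ ?_ <;>
    simp only [fst_smul, snd_smul, fst_mul, snd_mul, smul_sub, smul_add, smul_mul_assoc,
      mul_smul_comm, Quaternion.star_smul]

theorem conj_sub (x y : Octonion) : conj (x - y) = conj x - conj y := by
  refine Prod.ext ?_ ?_ <;>
    simp only [fst_sub, snd_sub, fst_conj, snd_conj, star_sub]
  abel

theorem conj_smul (r : ℝ) (x : Octonion) : conj (r • x) = r • conj x := by
  refine Prod.ext ?_ ?_ <;>
    simp only [fst_smul, snd_smul, fst_conj, snd_conj, smul_neg, Quaternion.star_smul]

theorem conj_conj (x : Octonion) : conj (conj x) = x := by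
  refine Prod.ext ?_ ?_ <;> simp only [fst_conj, snd_conj, star_star, neg_neg]

theorem conj_zero : conj 0 = 0 := by
  refine Prod.ext ?_ ?_ <;> simp only [fst_conj, snd_conj, fst_zero, snd_zero, star_zero, neg_zero]

protected theorem zero_mul (x : Octonion) : 0 * x = 0 := by
  refine Prod.ext ?_ ?_ <;> simp [fst_mul, snd_mul, fst_zero, snd_zero]

theorem mul_i_mul_i (x : Octonion) : x * i * i = -x := by
  apply ext_coords <;> simp [coords_i, fst_mul, snd_mul, fst_neg, snd_neg]

theorem smul_eq_of_mul_smul_i_add_eq_zero {w u : Octonion} {r : ℝ} (h : w * (r • i) + u = 0) :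
    r • w = u * i := by
  have hu : u = -(r • (w * i)) := by rw [← Octonion.mul_smul]; exact eq_neg_of_add_eq_zero_right h
  have hneg : -(r • (w * i)) = (-r) • (w * i) := (neg_smul _ _).symm
  rw [hu, hneg, Octonion.smul_mul, mul_i_mul_i, neg_smul_neg]

/-- The off-diagonal entries of a Jordan matrix with zero diagonal annihilating `(x, y, z)ᵀ`
vanish as soon as `b` has no components along `1`, `k` and `iℓ`. -/
theorem offDiag_eq_zero {x₂ y₂ y₃ z₂ z₃ z₄ z₈ : ℝ} (hx₂ : x₂ ≠ 0) (hy₃ : y₃ ≠ 0) (hz₈ : z₈ ≠ 0)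
    {a b c y z : Octonion} (hy : y = y₂ • i + y₃ • j)
    (hz : z = z₂ • i + z₃ • j + z₄ • k + z₈ • l)
    (hb₁ : b.1.re = 0) (hb₄ : b.1.imK = 0) (hb₇ : b.2.imI = 0)
    (h₀ : a * y + conj c * z = 0) (h₁ : conj a * (x₂ • i) + b * z = 0)
    (h₂ : c * (x₂ • i) + conj b * y = 0) : a = 0 ∧ b = 0 ∧ c = 0 := by
  have ha := smul_eq_of_mul_smul_i_add_eq_zero h₁
  have hc := smul_eq_of_mul_smul_i_add_eq_zero h₂
  have key : conj (b * z * i) * y + conj (conj b * y * i) * z = 0 := by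
    rw [← ha, ← hc, conj_smul, conj_smul, conj_conj, Octonion.smul_mul, Octonion.smul_mul,
      ← smul_add, h₀, smul_zero]
  have hb : b = 0 := by
    have e₁ := congrArg (fun w : Octonion => w.1.re) key
    have e₂ := congrArg (fun w : Octonion => w.1.imI) key
    have e₄ := congrArg (fun w : Octonion => w.1.imK) key
    have e₆ := congrArg (fun w : Octonion => w.2.imI) key
    have e₇ := congrArg (fun w : Octonion => w.2.imJ) key
    simp [hy, hz, coords_i, coords_j, coords_k, coords_l, fst_mul, snd_mul, fst_add, snd_add,
      fst_smul, snd_smul, fst_conj, snd_conj, coords_zero, hb₁, hb₄, hb₇] at e₁ e₂ e₄ e₆ e₇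
    have hb₈ : b.2.imK = 0 := by
      have : y₃ * z₈ * b.2.imK = 0 := by linear_combination (-1 / 2) * e₁
      simpa [hy₃, hz₈] using this
    have hb₅ : b.2.re = 0 := by
      have : y₃ * z₈ * b.2.re = 0 := by linear_combination (1 / 2) * e₄
      simpa [hy₃, hz₈] using this
    have hb₃ : b.1.imJ = 0 := by
      have : y₃ * z₈ * b.1.imJ = 0 := by linear_combination (-1 / 2) * e₆
      simpa [hy₃, hz₈] using this
    have hz : z₄ ^ 2 + z₈ ^ 2 ≠ 0 := by positivity
    have hb₂ : b.1.imI = 0 := by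
      have : y₃ * (z₄ ^ 2 + z₈ ^ 2) * b.1.imI = 0 := by
        linear_combination (1 / 2) * (z₄ * e₂ + z₈ * e₇) + z₄ ^ 2 * y₂ * hb₃
      simpa [hy₃, hz] using this
    have hb₆ : b.2.imJ = 0 := by
      have : y₃ * (z₄ ^ 2 + z₈ ^ 2) * b.2.imJ = 0 := by
        linear_combination (1 / 2) * (z₈ * e₂ - z₄ * e₇) + z₄ * z₈ * y₂ * hb₃
      simpa [hy₃, hz] using this
    exact ext_coords hb₁ hb₂ hb₃ hb₄ hb₅ hb₇ hb₆ hb₈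
  have eq_zero {w : Octonion} (h : x₂ • w = 0) : w = 0 := (smul_eq_zero.1 h).resolve_left hx₂
  refine ⟨?_, hb, eq_zero ?_⟩
  · rw [← conj_conj a, eq_zero (w := conj a), conj_zero]
    rw [ha, hb, Octonion.zero_mul, Octonion.zero_mul]
  · rw [hc, hb, conj_zero, Octonion.zero_mul, Octonion.zero_mul]

end Octonion

open Octonion in
/-- For a generic purely imaginary triple with nonzero associator, two Jordan matrices
admitting `v = (x,y,z)ᵀ` as eigenvector with eigenvalue `λ = [x,y,z]`, having the same
diagonal entries and whose entries `b`, `b'` agree in the `1`-, `k`-, and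
`iℓ`-directions, are equal: the family is uniquely parameterized by
`(p, m, n, b₁, b₄, b₇)`. -/
theorem six_parameter_family_unique (x y z : Octonion) (x₂ y₂ y₃ z₂ z₃ z₄ z₈ : ℝ)
    (hx : x = x₂ • i)
    (hy : y = y₂ • i + y₃ • j)
    (hz : z = z₂ • i + z₃ • j + z₄ • k + z₈ • l)
    (hne : x₂ * y₃ * z₈ ≠ 0)
    (p m n : ℝ) (a b c a' b' c' : Octonion)
    (b₁ b₂ b₃ b₄ b₅ b₆ b₇ b₈ b₂' b₃' b₅' b₆' b₈' : ℝ)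
    (hb : b = b₁ • 1 + b₂ • i + b₃ • j + b₄ • k + b₅ • (k * l) + b₆ • (j * l) +
      b₇ • (i * l) + b₈ • l)
    (hb' : b' = b₁ • 1 + b₂' • i + b₃' • j + b₄ • k + b₅' • (k * l) + b₆' • (j * l) +
      b₇ • (i * l) + b₈' • l)
    (heig : Eig !![ofReal p, a, conj c; conj a, ofReal m, b; c, conj b, ofReal n]
      ![x, y, z] (assoc x y z))
    (heig' : Eig !![ofReal p, a', conj c'; conj a', ofReal m, b'; c', conj b', ofReal n]
      ![x, y, z] (assoc x y z)) :
    !![ofReal p, a, conj c; conj a, ofReal m, b; c, conj b, ofReal n] =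
      !![ofReal p, a', conj c'; conj a', ofReal m, b'; c', conj b', ofReal n] := by
  obtain ⟨⟨hx₂, hy₃⟩, hz₈⟩ : (x₂ ≠ 0 ∧ y₃ ≠ 0) ∧ z₈ ≠ 0 := by
    simpa only [mul_ne_zero_iff] using hne
  have e₀ := sub_eq_zero.2 ((heig 0).trans (heig' 0).symm)
  have e₁ := sub_eq_zero.2 ((heig 1).trans (heig' 1).symm)
  have e₂ := sub_eq_zero.2 ((heig 2).trans (heig' 2).symm)
  simp only [Matrix.of_apply, Matrix.cons_val] at e₀ e₁ e₂
  obtain ⟨ha, hb, hc⟩ : a - a' = 0 ∧ b - b' = 0 ∧ c - c' = 0 := by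
    apply offDiag_eq_zero hx₂ hy₃ hz₈ hy hz
    · simp [hb, hb', coords_i, coords_j, coords_k, coords_l, fst_sub, fst_add, fst_smul,
        fst_mul, fst_one]
    · simp [hb, hb', coords_i, coords_j, coords_k, coords_l, fst_sub, fst_add, fst_smul,
        fst_mul, fst_one]
    · simp [hb, hb', coords_i, coords_j, coords_k, coords_l, snd_sub, snd_add, snd_smul,
        snd_mul, snd_one]
    · rw [conj_sub, Octonion.sub_mul, Octonion.sub_mul, ← e₀]
      abel
    · rw [← hx, conj_sub, Octonion.sub_mul, Octonion.sub_mul, ← e₁]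
      abel
    · rw [← hx, conj_sub, Octonion.sub_mul, Octonion.sub_mul, ← e₂]
      abel
  rw [sub_eq_zero.1 ha, sub_eq_zero.1 hb, sub_eq_zero.1 hc]
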